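/- Let d ≥ 2, let B ⊆ ℂ_p be non-empty, let M ≥ 1 with B ⊆ D̄_M(0), let 0 < δ ≤ 1 with D̄_δ(z) ⊆ B for all z ∈ B, let λ > 1, and set μ := min{|l|^{1/(l−1)} : l ∈ {2,…,d}} · δ, where |l| is the p-adic absolute value of the integer l. Let f and g be polynomial maps of degree d over ℂ_p such that |f'(z)| ≥ λ and |g'(z)| ≥ λ for all z ∈ B, f⁻¹(B) ⊆ B and g⁻¹(B) ⊆ B, the Julia set J(f) is non-empty, and |f(z) − g(z)| ≤ μ for all z ∈ B. Then J(g) is non-empty and there exists a homeomorphism h : J(f) → J(g) with h(f(z)) = g(h(z)) for all z ∈ J(f). -/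

import Mathlib

open Polynomial

noncomputable section

/-- The projective line over `K`: `K` together with a point at infinity (`none`). -/
def P1 (K : Type*) := Option K

variable {K : Type*}

/-- Inclusion of `K` into the projective line. -/
def toP1 : K → P1 K := some

/-- The point at infinity of the projective line. -/
def P1.infty : P1 K := none

/-- The extension of a polynomial map to the projective line, sending `∞` to `∞`. -/
def polyMap [CommRing K] (f : K[X]) : P1 K → P1 K :=
  fun z => Option.map (fun w => f.eval w) z

/-- The chordal metric on the projective line over a normed field. -/
def chordal [NormedField K] (x y : P1 K) : ℝ :=
  match x, y with
  | some z, some w => ‖z - w‖ / (max ‖z‖ 1 * max ‖w‖ 1)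
  | some z, none => 1 / max ‖z‖ 1
  | none, some w => 1 / max ‖w‖ 1
  | none, none => 0

/-- A subset of the projective line is `ρ`-open if around each of its points it contains a
ball with respect to the chordal metric. -/
def IsRhoOpen [NormedField K] (U : Set (P1 K)) : Prop :=
  ∀ x ∈ U, ∃ ε > 0, ∀ y, chordal x y < ε → y ∈ U

/-- The topology on the projective line induced by the chordal metric. -/
instance P1.instTopologicalSpace (K : Type*) [NormedField K] : TopologicalSpace (P1 K) where
  IsOpen := IsRhoOpen
  isOpen_univ := fun _ _ => ⟨1, one_pos, fun _ _ => trivial⟩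
  isOpen_inter := fun U V hU hV x hx => by
    obtain ⟨ε₁, hε₁, h₁⟩ := hU x hx.1
    obtain ⟨ε₂, hε₂, h₂⟩ := hV x hx.2
    exact ⟨min ε₁ ε₂, lt_min hε₁ hε₂, fun y hy =>
      ⟨h₁ y (lt_of_lt_of_le hy (min_le_left _ _)), h₂ y (lt_of_lt_of_le hy (min_le_right _ _))⟩⟩
  isOpen_sUnion := fun S hS x hx => by
    obtain ⟨U, hUS, hxU⟩ := hx
    obtain ⟨ε, hε, h⟩ := hS U hUS x hxU
    exact ⟨ε, hε, fun y hy => ⟨U, hUS, h y hy⟩⟩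

/-- The Fatou set of a polynomial map: the largest `ρ`-open subset of the projective line on
which the family of iterates is equicontinuous with respect to the chordal metric. -/
def fatou [NormedField K] (f : K[X]) : Set (P1 K) :=
  {x | ∃ U : Set (P1 K), x ∈ U ∧ IsRhoOpen U ∧
    ∀ y ∈ U, ∀ ε > 0, ∃ δ > 0, ∀ z : P1 K, chordal y z < δ →
      ∀ n : ℕ, chordal ((polyMap f)^[n] y) ((polyMap f)^[n] z) < ε}

/-- The Julia set of a polynomial map: the complement of the Fatou set. -/
def julia [NormedField K] (f : K[X]) : Set (P1 K) :=
  (fatou f)ᶜ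

/-- The dynamics of `f` and `g` on their Julia sets are conjugate: there is a homeomorphism
`h : J(f) → J(g)` with `h ∘ f = g ∘ h` on `J(f)`. -/
def JuliaConjugate [NormedField K] (f g : K[X]) : Prop :=
  ∃ h : (julia f) ≃ₜ (julia g),
    ∀ (z : P1 K) (hz : z ∈ julia f), ∃ hfz : polyMap f z ∈ julia f,
      (h ⟨polyMap f z, hfz⟩ : P1 K) = polyMap g (h ⟨z, hz⟩)

/-- `min {|l|^{1/(l-1)} : 2 ≤ l ≤ d}` where `|l|` is the `p`-adic absolute value of `l`. -/
def muFactor (p : ℕ) [Fact (Nat.Prime p)] (d : ℕ) : ℝ :=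
  sInf {x : ℝ | ∃ l : ℕ, 2 ≤ l ∧ l ≤ d ∧ x = ‖(l : ℚ_[p])‖ ^ ((1 : ℝ) / ((l : ℝ) - 1))}

section Ultrametric

variable [NormedField K]

theorem norm_sub_le_of_norm_sub_le [IsUltrametricDist K] {a b c : K} {r : ℝ}
    (ha : ‖a - c‖ ≤ r) (hb : ‖b - c‖ ≤ r) :
    ‖a - b‖ ≤ r := by
  have := IsUltrametricDist.norm_add_le_max (a - c) (c - b)
  rw [sub_add_sub_cancel, norm_sub_rev c b] at this
  exact this.trans (max_le ha hb)

/-- On the closed disk of radius `r` around `0`, the constant term of `q` strictly dominates all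
the other terms. -/
def ConstTermDominates (q : K[X]) (r : ℝ) : Prop :=
  ∀ l, 1 ≤ l → ‖q.coeff l‖ * r ^ l < ‖q.coeff 0‖

theorem norm_eval_le_of_norm_coeff_le [IsUltrametricDist K] {q : K[X]} {r C : ℝ}
    (hq : ∀ l, ‖q.coeff l‖ * r ^ l ≤ C) {x : K} (hx : ‖x‖ ≤ r) : ‖q.eval x‖ ≤ C := by
  rw [eval_eq_sum_range]
  refine IsUltrametricDist.norm_sum_le_of_forall_le_of_nonempty (by simp) fun i _ => ?_
  rw [norm_mul, norm_pow]
  exact le_trans (by gcongr) (hq i)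

theorem ConstTermDominates.coeff_le {q : K[X]} {r : ℝ} (hq : ConstTermDominates q r) (l : ℕ) :
    ‖q.coeff l‖ * r ^ l ≤ ‖q.coeff 0‖ := by
  rcases Nat.eq_zero_or_pos l with rfl | hl
  · simp
  · exact (hq l hl).le

theorem ConstTermDominates.norm_eval [IsUltrametricDist K] {q : K[X]} {r : ℝ}
    (hq : ConstTermDominates q r) {x : K}
    (hx : ‖x‖ ≤ r) : ‖q.eval x‖ = ‖q.coeff 0‖ := by
  have hlt : ‖∑ i ∈ Finset.range (q.natDegree + 1), q.coeff (i + 1) * x ^ (i + 1)‖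
      < ‖q.coeff 0‖ := by
    obtain ⟨i, -, hi⟩ := IsUltrametricDist.exists_norm_finsetSum_le_of_nonempty
      (t := Finset.range (q.natDegree + 1)) (by simp) fun i => q.coeff (i + 1) * x ^ (i + 1)
    refine hi.trans_lt (lt_of_le_of_lt ?_ (hq (i + 1) (by omega)))
    rw [norm_mul, norm_pow]
    gcongr
  rw [eval_eq_sum_range' (n := q.natDegree + 1 + 1) (by omega), Finset.sum_range_succ', pow_zero,
    mul_one, IsUltrametricDist.norm_add_eq_max_of_norm_ne_norm hlt.ne, max_eq_right hlt.le]

theorem constTermDominates_C {c : K} (hc : c ≠ 0) (r : ℝ) : ConstTermDominates (C c) r := by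
  intro l hl
  rw [coeff_C_of_ne_zero (by omega)]
  simpa using hc

theorem constTermDominates_X_sub_C {a : K} {r : ℝ} (hr : 0 ≤ r) (ha : r < ‖a‖) :
    ConstTermDominates (X - C a) r := by
  intro l hl
  rcases hl.eq_or_lt with rfl | hl
  · simpa [coeff_C] using ha
  · have h1 : (X - C a).coeff l = 0 := by
      rw [coeff_sub, coeff_X, coeff_C_of_ne_zero (by omega), if_neg (by omega), sub_zero]
    rw [h1]
    simpa using hr.trans_lt ha

theorem ConstTermDominates.mul [IsUltrametricDist K] {q s : K[X]} {r : ℝ}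
    (hr : 0 ≤ r) (hq : ConstTermDominates q r)
    (hs : ConstTermDominates s r) : ConstTermDominates (q * s) r := by
  intro l hl
  obtain ⟨⟨i, j⟩, hij, hle⟩ := IsUltrametricDist.exists_norm_finsetSum_le_of_nonempty
    (t := Finset.HasAntidiagonal.antidiagonal l) ⟨(0, l), by simp⟩
    fun x => q.coeff x.1 * s.coeff x.2
  rw [Finset.HasAntidiagonal.mem_antidiagonal] at hij
  dsimp only at hij hle
  rw [mul_coeff_zero, coeff_mul, norm_mul]
  rw [norm_mul] at hle
  have hq0 : 0 < ‖q.coeff 0‖ := lt_of_le_of_lt (by positivity) (hq 1 le_rfl)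
  have hs0 : 0 < ‖s.coeff 0‖ := lt_of_le_of_lt (by positivity) (hs 1 le_rfl)
  calc _ ≤ ‖q.coeff i‖ * ‖s.coeff j‖ * r ^ l := by gcongr
    _ = (‖q.coeff i‖ * r ^ i) * (‖s.coeff j‖ * r ^ j) := by rw [← hij, pow_add]; ring
    _ < ‖q.coeff 0‖ * ‖s.coeff 0‖ := by
      rcases Nat.eq_zero_or_pos i with hi | hi
      · exact mul_lt_mul' (hq.coeff_le i) (hs j (by omega)) (by positivity) hq0
      · exact (mul_le_mul_of_nonneg_left (hs.coeff_le j) (by positivity)).trans_lt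
          (mul_lt_mul_of_pos_right (hq i hi) hs0)

theorem constTermDominates_of_eval_ne_zero [IsAlgClosed K] [IsUltrametricDist K] {q : K[X]} {r : ℝ}
    (hr : 0 ≤ r)
    (hq : ∀ x, ‖x‖ ≤ r → q.eval x ≠ 0) : ConstTermDominates q r := by
  have hq0 : q ≠ 0 := by
    rintro rfl
    exact hq 0 (by simpa using hr) eval_zero
  have hroots : ∀ a ∈ q.roots, r < ‖a‖ := fun a ha => by
    by_contra! h
    exact hq a h (isRoot_of_mem_roots ha)
  have hprod : ∀ s : Multiset K, (∀ a ∈ s, r < ‖a‖) →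
      ConstTermDominates (s.map fun a => X - C a).prod r := by
    intro s
    induction s using Multiset.induction with
    | empty => intro _; simpa using constTermDominates_C (one_ne_zero (α := K)) r
    | cons a s ih =>
      intro h
      rw [Multiset.map_cons, Multiset.prod_cons]
      exact (constTermDominates_X_sub_C hr (h a (by simp))).mul hr
        (ih fun b hb => h b (by simp [hb]))
  rw [(IsAlgClosed.splits q).eq_prod_roots]
  exact (constTermDominates_C (leadingCoeff_ne_zero.mpr hq0) r).mul hr (hprod _ hroots)

theorem eval_sub_eval_eq_mul_eval_divX_taylor (f : K[X]) (z w : K) :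
    f.eval w - f.eval z = (w - z) * (taylor z f).divX.eval (w - z) := by
  have h := congrArg (eval (w - z)) (divX_mul_X_add (taylor z f))
  rw [taylor_eval, eval_add, eval_mul, eval_X, eval_C, taylor_coeff_zero, sub_add_cancel] at h
  rw [← h]; ring

theorem norm_eval_sub_eval_le_of_omits [IsAlgClosed K] [IsUltrametricDist K] {f : K[X]} {z b : K}
    {r : ℝ} (hr : 0 < r)
    (hb : ∀ w, ‖w - z‖ ≤ r → f.eval w ≠ b) {w : K} (hw : ‖w - z‖ ≤ r) :
    ‖f.eval w - f.eval z‖ ≤ ‖f.eval z - b‖ / r * ‖w - z‖ := by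
  have hdom : ConstTermDominates (taylor z (f - C b)) r := by
    refine constTermDominates_of_eval_ne_zero hr.le fun x hx => ?_
    rw [taylor_eval, eval_sub, eval_C, sub_ne_zero]
    exact hb _ (by simpa using hx)
  have hsub := eval_sub_eval_eq_mul_eval_divX_taylor (f - C b) z w
  have hle : ‖(taylor z (f - C b)).divX.eval (w - z)‖ ≤ ‖f.eval z - b‖ / r := by
    refine norm_eval_le_of_norm_coeff_le (fun l => ?_) hw
    rw [coeff_divX, le_div_iff₀ hr, mul_assoc, ← pow_succ]
    simpa using hdom.coeff_le (l + 1)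
  rw [eval_sub, eval_sub, eval_C, eval_C, sub_sub_sub_cancel_right] at hsub
  rw [hsub, norm_mul, mul_comm]
  gcongr

/-- If every Taylor coefficient of `f` at `z` of order at least `2` is dominated by the linear one
on the disk of radius `r`, then `f` scales distances to `z` by `‖f' z‖` on that disk. -/
theorem norm_eval_sub_eval_eq [IsUltrametricDist K] {f : K[X]} {z : K} {r : ℝ}
    (hf : ConstTermDominates (taylor z f).divX r) {w : K} (hw : ‖w - z‖ ≤ r) :
    ‖f.eval w - f.eval z‖ = ‖(derivative f).eval z‖ * ‖w - z‖ := by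
  rw [eval_sub_eval_eq_mul_eval_divX_taylor, norm_mul, hf.norm_eval hw, coeff_divX,
    taylor_coeff_one, mul_comm]

theorem exists_eval_eq_of_norm_sub_le [IsAlgClosed K] [IsUltrametricDist K] {f : K[X]} {z y : K}
    {r : ℝ} (hr : 0 ≤ r)
    (hy : ‖y - f.eval z‖ ≤ ‖(derivative f).eval z‖ * r) : ∃ u, ‖u - z‖ ≤ r ∧ f.eval u = y := by
  by_contra! h
  have hdom : ConstTermDominates (taylor z (f - C y)) r := by
    refine constTermDominates_of_eval_ne_zero hr fun x hx => ?_
    rw [taylor_eval, eval_sub, eval_C, sub_ne_zero]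
    exact h _ (by simpa using hx)
  have h1 := hdom 1 le_rfl
  rw [taylor_coeff_one, taylor_coeff_zero, derivative_sub, derivative_C, sub_zero, pow_one,
    eval_sub, eval_C, norm_sub_rev] at h1
  exact h1.not_ge hy

end Ultrametric

section MuFactor

variable {p : ℕ} [Fact (Nat.Prime p)]

theorem muFactor_le {d l : ℕ} (hl : 2 ≤ l) (hld : l ≤ d) :
    muFactor p d ≤ ‖(l : ℚ_[p])‖ ^ ((1 : ℝ) / ((l : ℝ) - 1)) := by
  refine csInf_le ⟨0, ?_⟩ ⟨l, hl, hld, rfl⟩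
  rintro x ⟨l, -, -, rfl⟩
  positivity

theorem muFactor_pos {d : ℕ} (hd : 2 ≤ d) : 0 < muFactor p d := by
  have hfin : {x : ℝ | ∃ l : ℕ, 2 ≤ l ∧ l ≤ d ∧
      x = ‖(l : ℚ_[p])‖ ^ ((1 : ℝ) / ((l : ℝ) - 1))}.Finite := by
    refine ((Set.finite_Iic d).image
      fun l : ℕ => ‖(l : ℚ_[p])‖ ^ ((1 : ℝ) / ((l : ℝ) - 1))).subset ?_
    rintro x ⟨l, -, hld, rfl⟩
    exact ⟨l, hld, rfl⟩
  obtain ⟨l, hl, -, h⟩ := Set.Nonempty.csInf_mem (by exact ⟨_, 2, le_rfl, hd, rfl⟩) hfin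
  have hl0 : 0 < ‖(l : ℚ_[p])‖ := norm_pos_iff.mpr (by exact_mod_cast (by omega : l ≠ 0))
  rw [muFactor, h]
  positivity

theorem muFactor_le_one {d : ℕ} (hd : 2 ≤ d) : muFactor p d ≤ 1 := by
  refine (muFactor_le le_rfl hd).trans (Real.rpow_le_one (norm_nonneg _) ?_ ?_)
  · exact_mod_cast Padic.norm_int_le_one 2
  · norm_num

theorem muFactor_pow_le {d l : ℕ} (hl : 2 ≤ l) (hld : l ≤ d) :
    muFactor p d ^ (l - 1) ≤ ‖(l : ℚ_[p])‖ := by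
  have hl1 : ((l - 1 : ℕ) : ℝ) = (l : ℝ) - 1 := by rw [Nat.cast_sub (by omega)]; simp
  refine (pow_le_pow_left₀ (muFactor_pos (hl.trans hld)).le (muFactor_le hl hld) _).trans_eq ?_
  rw [one_div, ← hl1]
  exact Real.rpow_inv_natCast_pow (norm_nonneg _) (by omega)

variable [NormedField K] [IsAlgClosed K] [IsUltrametricDist K] [Algebra ℚ_[p] K]

theorem constTermDominates_divX_taylor (hext : ∀ q : ℚ_[p], ‖algebraMap ℚ_[p] K q‖ = ‖q‖)
    {d : ℕ} {f : K[X]} (hdeg : f.natDegree = d) {z : K} {δ : ℝ} (hδ : 0 < δ)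
    (hf : ∀ w, ‖w - z‖ ≤ δ → (derivative f).eval w ≠ 0) :
    ConstTermDominates (taylor z f).divX (muFactor p d * δ) := by
  have hdom : ConstTermDominates (derivative (taylor z f)) δ := by
    refine constTermDominates_of_eval_ne_zero hδ.le fun x hx => ?_
    have hder : derivative (taylor z f) = taylor z (derivative f) := by
      simp [taylor_apply, derivative_comp]
    rw [hder, taylor_eval]
    exact hf _ (by simpa using hx)
  intro l hl
  have h := hdom l hl
  simp only [coeff_derivative, zero_add, Nat.cast_zero, mul_one] at h
  rw [coeff_divX, coeff_divX, zero_add]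
  rcases lt_or_ge d (l + 1) with hlt | hle
  · rw [coeff_eq_zero_of_natDegree_lt (by rwa [natDegree_taylor, hdeg])] at h ⊢
    simpa using h
  refine lt_of_le_of_lt ?_ h
  have hcast : ‖((l : K) + 1)‖ = ‖((l + 1 : ℕ) : ℚ_[p])‖ := by
    rw [← hext]; simp
  have hpow := muFactor_pow_le (p := p) (show 2 ≤ l + 1 by omega) hle
  rw [norm_mul, hcast, mul_pow, mul_assoc]
  simp only [Nat.add_sub_cancel] at hpow
  gcongr

end MuFactor

section Shadowing

/-- The set of points whose whole forward orbit under `F` stays in `B`. -/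
def orbitSet (F : K → K) (B : Set K) : Set K := {z | ∀ n, F^[n] z ∈ B}

theorem map_mem_orbitSet {F : K → K} {B : Set K} {z : K} (hz : z ∈ orbitSet F B) :
    F z ∈ orbitSet F B := fun n => hz (n + 1)

variable [NormedField K]

/-- `F` expands distances to points of `B` by the factor `lam` on disks of radius `μ`. -/
def ExpandsOn (F : K → K) (B : Set K) (lam μ : ℝ) : Prop :=
  ∀ v ∈ B, ∀ u, ‖u - v‖ ≤ μ → lam * ‖u - v‖ ≤ ‖F u - F v‖

/-- The image under `F` of every disk of radius `μ` centered in `B` contains the disk of radius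
`μ` around the image of the center. -/
def CoversDisksOn (F : K → K) (B : Set K) (μ : ℝ) : Prop :=
  ∀ v ∈ B, ∀ y, ‖y - F v‖ ≤ μ → ∃ u, ‖u - v‖ ≤ μ ∧ F u = y

variable {F G : K → K} {B : Set K} {lam μ : ℝ}

theorem ExpandsOn.pow_mul_norm_sub_le (hF : ExpandsOn F B lam μ) (hlam : 0 ≤ lam) (N : ℕ) :
    ∀ u v, (∀ n ≤ N, F^[n] v ∈ B) → (∀ n ≤ N, ‖F^[n] u - F^[n] v‖ ≤ μ) →
      lam ^ N * ‖u - v‖ ≤ μ := by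
  induction N with
  | zero => intro u v _ h; simpa using h 0 le_rfl
  | succ N ih =>
    intro u v hv h
    have h1 := ih (F u) (F v) (fun n hn => hv (n + 1) (by omega)) fun n hn => h (n + 1) (by omega)
    refine le_trans ?_ h1
    rw [pow_succ, mul_assoc]
    exact mul_le_mul_of_nonneg_left (hF v (hv 0 (by omega)) u (h 0 (by omega))) (by positivity)

theorem ExpandsOn.eq_of_norm_iterate_sub_le (hF : ExpandsOn F B lam μ) (hlam : 1 < lam) {u v : K}
    (hv : v ∈ orbitSet F B) (h : ∀ n, ‖F^[n] u - F^[n] v‖ ≤ μ) : u = v := by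
  by_contra hne
  have hpos : 0 < ‖u - v‖ := norm_pos_iff.mpr (sub_ne_zero.mpr hne)
  obtain ⟨N, hN⟩ := pow_unbounded_of_one_lt (μ / ‖u - v‖) hlam
  have h1 := hF.pow_mul_norm_sub_le (by linarith) N u v (fun n _ => hv n) fun n _ => h n
  rw [div_lt_iff₀ hpos] at hN
  exact hN.not_ge h1

variable [IsUltrametricDist K]

theorem CoversDisksOn.exists_shadow_of_le (hG : CoversDisksOn G B μ) (hμ : 0 ≤ μ) (N : ℕ) :
    ∀ z : ℕ → K, (∀ n, z n ∈ B) → (∀ n, ‖G (z n) - z (n + 1)‖ ≤ μ) →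
      ∃ y, ∀ n ≤ N, ‖G^[n] y - z n‖ ≤ μ := by
  induction N with
  | zero =>
    intro z _ _
    refine ⟨z 0, fun n hn => ?_⟩
    obtain rfl : n = 0 := by omega
    simpa using hμ
  | succ N ih =>
    intro z hz hGz
    obtain ⟨y, hy⟩ := ih (fun n => z (n + 1)) (fun n => hz _) fun n => hGz _
    obtain ⟨u, hu, rfl⟩ := hG (z 0) (hz 0) y
      (norm_sub_le_of_norm_sub_le (hy 0 (by omega)) (hGz 0))
    refine ⟨u, fun n hn => ?_⟩
    cases n with
    | zero => exact hu
    | succ n => exact hy n (by omega)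

theorem exists_shadow [CompleteSpace K] (hE : ExpandsOn G B lam μ) (hC : CoversDisksOn G B μ)
    (hcont : Continuous G) (hlam : 1 < lam) (hμ : 0 ≤ μ)
    (hthick : ∀ v ∈ B, ∀ u, ‖u - v‖ ≤ μ → u ∈ B) {z : ℕ → K} (hz : ∀ n, z n ∈ B)
    (hGz : ∀ n, ‖G (z n) - z (n + 1)‖ ≤ μ) : ∃ y, ∀ n, ‖G^[n] y - z n‖ ≤ μ := by
  choose y hy using fun N => hC.exists_shadow_of_le hμ N z hz hGz
  have hbound : ∀ N m, N ≤ m → ‖y m - y N‖ ≤ μ * lam⁻¹ ^ N := by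
    intro N m hNm
    have h := hE.pow_mul_norm_sub_le (by linarith) N (y m) (y N)
      (fun n hn => hthick _ (hz n) _ (hy N n hn))
      fun n hn => norm_sub_le_of_norm_sub_le (hy m n (hn.trans hNm)) (hy N n hn)
    rw [inv_pow, ← div_eq_mul_inv, le_div_iff₀ (by positivity), mul_comm]
    exact h
  have hcauchy : CauchySeq y := by
    refine cauchySeq_of_le_geometric lam⁻¹ μ (inv_lt_one_of_one_lt₀ hlam) fun n => ?_
    rw [dist_comm, dist_eq_norm]
    exact hbound n (n + 1) (by omega)
  obtain ⟨x, hx⟩ := cauchySeq_tendsto_of_complete hcauchy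
  refine ⟨x, fun n => ?_⟩
  have hlim := (((hcont.iterate n).tendsto x).comp hx).sub_const (z n)
  refine le_of_tendsto hlim.norm ?_
  filter_upwards [Filter.eventually_ge_atTop n] with N hN using hy N n hN

/-- A map sending each point of `orbitSet F B` to a point whose `G`-orbit shadows its `F`-orbit
is continuous. -/
theorem continuous_of_shadow {h : orbitSet F B → orbitSet G B} (hE : ExpandsOn G B lam μ)
    (hcont : Continuous F) (hlam : 1 < lam) (hμ : 0 < μ)
    (hh : ∀ (z : orbitSet F B) (n : ℕ), ‖G^[n] (h z) - F^[n] z‖ ≤ μ) : Continuous h := by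
  rw [Metric.continuous_iff]
  intro z ε hε
  obtain ⟨N, hN⟩ := pow_unbounded_of_one_lt (μ / ε) hlam
  have hclose : ∀ᶠ w : K in nhds (z : K), ∀ n ∈ Finset.range (N + 1),
      ‖F^[n] w - F^[n] z‖ < μ := by
    rw [Filter.eventually_all_finset]
    intro n _
    have := (hcont.iterate n).tendsto (z : K) (Metric.ball_mem_nhds _ hμ)
    filter_upwards [this] with w hw
    simpa [dist_eq_norm] using hw
  obtain ⟨r, hr, hball⟩ := Metric.eventually_nhds_iff.mp hclose
  refine ⟨r, hr, fun w hw => ?_⟩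
  rw [Subtype.dist_eq, dist_eq_norm]
  have hle : lam ^ N * ‖(h w : K) - h z‖ ≤ μ := by
    refine hE.pow_mul_norm_sub_le (by linarith) N _ _ (fun n _ => (h z).2 n) fun n hn => ?_
    refine norm_sub_le_of_norm_sub_le (c := F^[n] z) ?_ (hh z n)
    have h1 := (hball hw n (Finset.mem_range.mpr (by omega))).le
    refine norm_sub_le_of_norm_sub_le (c := F^[n] w) (hh w n) ?_
    rwa [norm_sub_rev]
  rw [div_lt_iff₀ hε] at hN
  exact lt_of_mul_lt_mul_left (hle.trans_lt hN) (by positivity)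

/-- Two uniformly close expanding maps are conjugate on the sets of points whose orbits stay in
the region of expansion. -/
theorem exists_homeomorph_orbitSet [CompleteSpace K] (hEF : ExpandsOn F B lam μ)
    (hCF : CoversDisksOn F B μ) (hFcont : Continuous F) (hEG : ExpandsOn G B lam μ)
    (hCG : CoversDisksOn G B μ) (hGcont : Continuous G) (hlam : 1 < lam) (hμ : 0 < μ)
    (hthick : ∀ v ∈ B, ∀ u, ‖u - v‖ ≤ μ → u ∈ B) (hFG : ∀ z ∈ B, ‖F z - G z‖ ≤ μ) :
    ∃ h : orbitSet F B ≃ₜ orbitSet G B,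
      ∀ z : orbitSet F B, (h ⟨F z, map_mem_orbitSet z.2⟩ : K) = G (h z) := by
  have hexF : ∀ z : orbitSet F B, ∃ y : orbitSet G B, ∀ n, ‖G^[n] y - F^[n] z‖ ≤ μ := by
    intro z
    obtain ⟨y, hy⟩ := exists_shadow hEG hCG hGcont hlam hμ.le hthick z.2 fun n => by
      rw [Function.iterate_succ_apply', norm_sub_rev]
      exact hFG _ (z.2 n)
    exact ⟨⟨y, fun n => hthick _ (z.2 n) _ (hy n)⟩, hy⟩
  have hexG : ∀ z : orbitSet G B, ∃ y : orbitSet F B, ∀ n, ‖F^[n] y - G^[n] z‖ ≤ μ := by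
    intro z
    obtain ⟨y, hy⟩ := exists_shadow hEF hCF hFcont hlam hμ.le hthick z.2 fun n => by
      rw [Function.iterate_succ_apply']
      exact hFG _ (z.2 n)
    exact ⟨⟨y, fun n => hthick _ (z.2 n) _ (hy n)⟩, hy⟩
  choose h hh using hexF
  choose k hk using hexG
  refine ⟨⟨⟨h, k, fun z => ?_, fun z => ?_⟩, continuous_of_shadow hEG hFcont hlam hμ hh,
    continuous_of_shadow hEF hGcont hlam hμ hk⟩, fun z => ?_⟩
  · refine Subtype.ext (hEF.eq_of_norm_iterate_sub_le hlam z.2 fun n => ?_)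
    refine norm_sub_le_of_norm_sub_le (hk (h z) n) ?_
    rw [norm_sub_rev]
    exact hh z n
  · refine Subtype.ext (hEG.eq_of_norm_iterate_sub_le hlam z.2 fun n => ?_)
    refine norm_sub_le_of_norm_sub_le (hh (k z) n) ?_
    rw [norm_sub_rev]
    exact hk z n
  · exact hEG.eq_of_norm_iterate_sub_le hlam (map_mem_orbitSet (h z).2) fun n =>
      norm_sub_le_of_norm_sub_le (hh ⟨F z, map_mem_orbitSet z.2⟩ n) (hh z (n + 1))

end Shadowing

section ProjectiveLine

theorem P1.cases (x : P1 K) : x = P1.infty ∨ ∃ z : K, x = toP1 z := by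
  cases x with
  | none => exact Or.inl rfl
  | some z => exact Or.inr ⟨z, rfl⟩

theorem toP1_injective : Function.Injective (toP1 : K → P1 K) := Option.some_injective K

variable [NormedField K]

theorem chordal_toP1 (z w : K) :
    chordal (toP1 z) (toP1 w) = ‖z - w‖ / (max ‖z‖ 1 * max ‖w‖ 1) := rfl

theorem chordal_toP1_infty (z : K) : chordal (toP1 z) P1.infty = 1 / max ‖z‖ 1 := rfl

theorem chordal_infty_toP1 (z : K) : chordal P1.infty (toP1 z) = 1 / max ‖z‖ 1 := rfl

theorem chordal_infty_infty : chordal (P1.infty : P1 K) P1.infty = 0 := rfl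

theorem polyMap_toP1 (f : K[X]) (z : K) : polyMap f (toP1 z) = toP1 (f.eval z) := rfl

theorem iterate_polyMap_toP1 (f : K[X]) (n : ℕ) (z : K) :
    (polyMap f)^[n] (toP1 z) = toP1 ((fun w => f.eval w)^[n] z) := by
  induction n generalizing z with
  | zero => rfl
  | succ n ih => rw [Function.iterate_succ_apply, polyMap_toP1, ih]; rfl

theorem iterate_polyMap_infty (f : K[X]) (n : ℕ) :
    (polyMap f)^[n] P1.infty = P1.infty :=
  Function.iterate_fixed rfl n

theorem chordal_toP1_le {z w : K} {C : ℝ} (h : ‖z - w‖ ≤ C * max ‖z‖ 1) :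
    chordal (toP1 z) (toP1 w) ≤ C := by
  have hz : 0 < max ‖z‖ 1 := lt_max_of_lt_right one_pos
  have hw : 1 ≤ max ‖w‖ 1 := le_max_right _ _
  rw [chordal_toP1, div_le_iff₀ (by positivity)]
  refine h.trans ?_
  have hC : 0 ≤ C := by
    by_contra! hC
    have := (norm_nonneg _).trans h
    nlinarith
  rw [← mul_assoc]
  exact le_mul_of_one_le_right (by positivity) hw

theorem chordal_toP1_le_norm_sub (z w : K) : chordal (toP1 z) (toP1 w) ≤ ‖z - w‖ :=
  chordal_toP1_le (le_mul_of_one_le_right (norm_nonneg _) (le_max_right _ _))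

/-- A point which is chordally close to a finite point of norm at most `R` is finite and close
to it in norm. -/
theorem exists_toP1_of_chordal_lt [IsUltrametricDist K] {R r : ℝ} (hR : 1 ≤ R) {z : K}
    (hz : ‖z‖ ≤ R) {x : P1 K} (hx : chordal (toP1 z) x < min (1 / R) (r / R ^ 2)) :
    ∃ w, x = toP1 w ∧ ‖w - z‖ < r := by
  have hR0 : 0 < R := by linarith
  have hzR : max ‖z‖ 1 ≤ R := max_le hz hR
  have hz0 : 0 < max ‖z‖ 1 := lt_max_of_lt_right one_pos
  obtain ⟨hx1, hx2⟩ := lt_min_iff.mp hx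
  rcases x.cases with rfl | ⟨w, rfl⟩
  · rw [chordal_toP1_infty] at hx1
    exact absurd (one_div_le_one_div_of_le hz0 hzR) hx1.not_ge
  · refine ⟨w, rfl, ?_⟩
    have hw0 : 0 < max ‖w‖ 1 := lt_max_of_lt_right one_pos
    have hwR : ‖w‖ ≤ R := by
      by_contra! hw
      have hnorm : ‖z - w‖ = ‖w‖ := by
        rw [sub_eq_add_neg, IsUltrametricDist.norm_add_eq_max_of_norm_ne_norm
          (by rw [norm_neg]; exact (hz.trans_lt hw).ne), norm_neg, max_eq_right (hz.trans hw.le)]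
      rw [chordal_toP1, hnorm, max_eq_left (hR.trans hw.le), mul_comm,
        div_mul_cancel_left₀ (hR0.trans hw).ne', ← one_div] at hx1
      exact absurd (one_div_le_one_div_of_le hz0 hzR) hx1.not_ge
    rw [chordal_toP1, div_lt_div_iff₀ (by positivity) (by positivity)] at hx2
    have hr : 0 < r := by
      by_contra! hr
      have h1 : 0 ≤ ‖z - w‖ * R ^ 2 := by positivity
      have h2 : r * (max ‖z‖ 1 * max ‖w‖ 1) ≤ 0 :=
        mul_nonpos_of_nonpos_of_nonneg hr (by positivity)
      linarith
    have h3 : r * (max ‖z‖ 1 * max ‖w‖ 1) ≤ r * R ^ 2 := by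
      rw [pow_two]
      gcongr
      exact max_le hwR hR
    rw [norm_sub_rev]
    exact lt_of_mul_lt_mul_right (hx2.trans_le h3) (by positivity)

theorem exists_chordal_ball_subset [IsUltrametricDist K] (z : K) {r : ℝ} (hr : 0 < r) :
    ∃ ε > 0, ∀ x, chordal (toP1 z) x < ε → ∃ w, x = toP1 w ∧ ‖w - z‖ < r := by
  have hR : 0 < max ‖z‖ 1 := lt_max_of_lt_right one_pos
  exact ⟨min (1 / max ‖z‖ 1) (r / max ‖z‖ 1 ^ 2), by positivity, fun x hx =>
    exists_toP1_of_chordal_lt (le_max_right _ _) (le_max_left _ _) hx⟩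

theorem isOpenEmbedding_toP1 [IsUltrametricDist K] :
    Topology.IsOpenEmbedding (toP1 : K → P1 K) := by
  refine .of_continuous_injective_isOpenMap ?_ toP1_injective ?_
  · refine ⟨fun U hU => Metric.isOpen_iff.mpr fun z hz => ?_⟩
    obtain ⟨ε, hε, h⟩ := hU (toP1 z) hz
    refine ⟨ε, hε, fun w hw => h _ ((chordal_toP1_le_norm_sub z w).trans_lt ?_)⟩
    rwa [← dist_eq_norm, dist_comm]
  · rintro V hV _ ⟨z, hz, rfl⟩
    obtain ⟨r, hr, hball⟩ := Metric.isOpen_iff.mp hV z hz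
    obtain ⟨ε, hε, h⟩ := exists_chordal_ball_subset z hr
    refine ⟨ε, hε, fun x hx => ?_⟩
    obtain ⟨w, rfl, hw⟩ := h x hx
    exact ⟨w, hball (by rwa [Metric.mem_ball, dist_eq_norm]), rfl⟩

/-- Equicontinuity at `x`, for the chordal metric, of the family of iterates of `f`. -/
def EquicontinuousIteratesAt (f : K[X]) (x : P1 K) : Prop :=
  ∀ ε > 0, ∃ δ > 0, ∀ y : P1 K, chordal x y < δ →
    ∀ n : ℕ, chordal ((polyMap f)^[n] x) ((polyMap f)^[n] y) < ε

theorem exists_norm_le_norm_eval {f : K[X]} (hf : 2 ≤ f.natDegree) :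
    ∃ R : ℝ, ∀ w : K, R ≤ ‖w‖ → ‖w‖ ≤ ‖f.eval w‖ := by
  have hdeg : 0 < degree f.divX := by
    rw [← natDegree_pos_iff_degree_pos, natDegree_divX_eq_natDegree_tsub_one]
    omega
  have htend : Filter.Tendsto (fun w : K => ‖f.divX.eval w‖)
      (Filter.comap norm Filter.atTop) Filter.atTop :=
    tendsto_norm_atTop _ hdeg Filter.tendsto_comap
  have hev := htend.eventually_ge_atTop 2
  rw [Filter.eventually_comap, Filter.eventually_atTop] at hev
  obtain ⟨R, hR⟩ := hev
  refine ⟨max R ‖f.coeff 0‖, fun w hw => ?_⟩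
  have h2 : 2 ≤ ‖f.divX.eval w‖ := hR _ ((le_max_left _ _).trans hw) w rfl
  have h0 : ‖f.coeff 0‖ ≤ ‖w‖ := (le_max_right _ _).trans hw
  have heq : f.eval w - f.coeff 0 = f.divX.eval w * w := by
    conv_lhs => rw [← divX_mul_X_add f]
    simp
  have hle := norm_sub_le (f.eval w) (f.coeff 0)
  rw [heq, norm_mul] at hle
  nlinarith [norm_nonneg w]

theorem equicontinuousIteratesAt_infty {f : K[X]} (hf : 2 ≤ f.natDegree) :
    EquicontinuousIteratesAt f P1.infty := by
  intro ε hε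
  obtain ⟨R, hR⟩ := exists_norm_le_norm_eval hf
  have hR' : 0 < max R 1 := lt_max_of_lt_right one_pos
  refine ⟨min ε (1 / max R 1), by positivity, fun x hx n => ?_⟩
  obtain ⟨hx1, hx2⟩ := lt_min_iff.mp hx
  rw [iterate_polyMap_infty]
  rcases x.cases with rfl | ⟨w, rfl⟩
  · rwa [iterate_polyMap_infty, chordal_infty_infty]
  · have hw0 : 0 < max ‖w‖ 1 := lt_max_of_lt_right one_pos
    rw [chordal_infty_toP1, one_div_lt_one_div hw0 hR'] at hx2
    have hRw : R ≤ ‖w‖ := by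
      rcases lt_max_iff.mp hx2 with h | h
      · exact (le_max_left _ _).trans h.le
      · exact absurd (le_max_right R 1) h.not_ge
    have hgrow : ‖w‖ ≤ ‖(fun w => f.eval w)^[n] w‖ := by
      induction n with
      | zero => rfl
      | succ n ih =>
        rw [Function.iterate_succ_apply']
        exact ih.trans (hR _ (hRw.trans ih))
    rw [chordal_infty_toP1] at hx1
    rw [iterate_polyMap_toP1, chordal_infty_toP1]
    exact lt_of_le_of_lt (one_div_le_one_div_of_le hw0 (max_le_max_right 1 hgrow)) hx1

variable [IsUltrametricDist K]

theorem EquicontinuousIteratesAt.of_eval {f : K[X]} {z : K}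
    (h : EquicontinuousIteratesAt f (toP1 (f.eval z))) :
    EquicontinuousIteratesAt f (toP1 z) := by
  intro ε hε
  obtain ⟨δ, hδ, hδε⟩ := h ε hε
  obtain ⟨r, hr, hfr⟩ := Metric.continuous_iff.mp f.continuous z δ hδ
  obtain ⟨η, hη, hball⟩ := exists_chordal_ball_subset z hr
  refine ⟨min η ε, lt_min hη hε, fun x hx n => ?_⟩
  obtain ⟨w, rfl, hw⟩ := hball x (hx.trans_le (min_le_left _ _))
  cases n with
  | zero => exact hx.trans_le (min_le_right _ _)
  | succ n =>
    refine hδε _ ((chordal_toP1_le_norm_sub _ _).trans_lt ?_) n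
    rw [← dist_eq_norm, dist_comm]
    exact hfr w (by rwa [dist_eq_norm])

theorem EquicontinuousIteratesAt.of_iterate {f : K[X]} {z : K} (n : ℕ)
    (h : EquicontinuousIteratesAt f (toP1 ((fun w => f.eval w)^[n] z))) :
    EquicontinuousIteratesAt f (toP1 z) := by
  induction n generalizing z with
  | zero => exact h
  | succ n ih => exact (ih h).of_eval

theorem equicontinuousIteratesAt_of_omits [IsAlgClosed K] {f : K[X]} {z b : K} {r : ℝ}
    (hr : 0 < r) (hb : ∀ n w, ‖w - z‖ ≤ r → (fun w => f.eval w)^[n] w ≠ b) :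
    EquicontinuousIteratesAt f (toP1 z) := by
  intro ε hε
  set M : ℝ := max ‖b‖ 1
  have hM : 0 < M := lt_max_of_lt_right one_pos
  obtain ⟨η, hη, hball⟩ := exists_chordal_ball_subset z
    (show 0 < min r (ε * r / M) by positivity)
  refine ⟨η, hη, fun x hx n => ?_⟩
  obtain ⟨w, rfl, hw⟩ := hball x hx
  obtain ⟨hw1, hw2⟩ := lt_min_iff.mp hw
  have heval : ∀ w, (f.comp^[n] X).eval w = (fun w => f.eval w)^[n] w := fun w => by
    rw [iterate_comp_eval, eval_X]
  have hle := norm_eval_sub_eval_le_of_omits (f := f.comp^[n] X) (b := b) hr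
    (fun w hw => by rw [heval]; exact hb n w hw) hw1.le
  rw [heval, heval, norm_sub_rev] at hle
  rw [iterate_polyMap_toP1, iterate_polyMap_toP1]
  set y := (fun w => f.eval w)^[n] z
  have hyb : ‖y - b‖ ≤ M * max ‖y‖ 1 := by
    have h1 := IsUltrametricDist.norm_add_le_max y (-b)
    rw [← sub_eq_add_neg, norm_neg] at h1
    refine h1.trans (max_le ?_ ?_)
    · exact (le_max_left _ _).trans (le_mul_of_one_le_left (by positivity) (le_max_right _ _))
    · exact (le_max_left _ _).trans (le_mul_of_one_le_right hM.le (le_max_right _ _))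
  have hchordal : chordal (toP1 y) (toP1 ((fun w => f.eval w)^[n] w)) ≤ M / r * ‖w - z‖ := by
    refine chordal_toP1_le (hle.trans ?_)
    calc ‖y - b‖ / r * ‖w - z‖ ≤ (M * max ‖y‖ 1) / r * ‖w - z‖ := by gcongr
      _ = M / r * ‖w - z‖ * max ‖y‖ 1 := by ring
  refine hchordal.trans_lt ?_
  rw [lt_div_iff₀ hM] at hw2
  rw [div_mul_eq_mul_div, div_lt_iff₀ hr]
  linarith

theorem not_equicontinuousIteratesAt {f : K[X]} {B : Set K} {lam μ M : ℝ}
    (hE : ExpandsOn (fun w => f.eval w) B lam μ) (hlam : 1 < lam) (hμ : 0 < μ) (hM : 1 ≤ M)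
    (hBM : B ⊆ Metric.closedBall 0 M) (hK : ∀ ε > 0, ∃ x : K, 0 < ‖x‖ ∧ ‖x‖ < ε) {z : K}
    (hz : z ∈ orbitSet (fun w => f.eval w) B) : ¬ EquicontinuousIteratesAt f (toP1 z) := by
  intro h
  obtain ⟨δ, hδ, hδε⟩ := h (min (1 / M) (μ / M ^ 2)) (by positivity)
  obtain ⟨x, hx0, hxδ⟩ := hK δ hδ
  have hclose : chordal (toP1 z) (toP1 (z + x)) < δ :=
    (chordal_toP1_le_norm_sub _ _).trans_lt (by simpa using hxδ)
  have heq : z + x = z := by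
    refine hE.eq_of_norm_iterate_sub_le hlam hz fun n => ?_
    have hn := hδε _ hclose n
    rw [iterate_polyMap_toP1, iterate_polyMap_toP1] at hn
    obtain ⟨w, hw, hwn⟩ := exists_toP1_of_chordal_lt hM (by simpa using hBM (hz n)) hn
    rw [toP1_injective hw]
    exact hwn.le
  rw [add_eq_left] at heq
  simp [heq] at hx0

/-- If `f` is expanding on a bounded thick backward invariant set `B`, its Julia set consists of
the points whose orbits stay in `B`. -/
theorem julia_eq_image_orbitSet [IsAlgClosed K] {f : K[X]} (hf : 2 ≤ f.natDegree) {B : Set K}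
    (hB : B.Nonempty) {lam μ M δ : ℝ} (hE : ExpandsOn (fun w => f.eval w) B lam μ)
    (hlam : 1 < lam) (hμ : 0 < μ) (hM : 1 ≤ M) (hBM : B ⊆ Metric.closedBall 0 M) (hδ : 0 < δ)
    (hthick : ∀ z ∈ B, Metric.closedBall z δ ⊆ B) (hinv : (fun z => f.eval z) ⁻¹' B ⊆ B)
    (hK : ∀ ε > 0, ∃ x : K, 0 < ‖x‖ ∧ ‖x‖ < ε) :
    julia f = toP1 '' orbitSet (fun w => f.eval w) B := by
  obtain ⟨b, hb⟩ := hB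
  have hinv' : ∀ n w, (fun w => f.eval w)^[n] w ∈ B → w ∈ B := by
    intro n
    induction n with
    | zero => exact fun w hw => hw
    | succ n ih => exact fun w hw => hinv (ih _ hw)
  have hdisk : ∀ {z w : K}, z ∉ B → ‖w - z‖ ≤ δ → w ∉ B := fun hz hwz hw =>
    hz (hthick _ hw (by rwa [Metric.mem_closedBall, dist_comm, dist_eq_norm]))
  have hequi : ∀ x ∉ toP1 '' orbitSet (fun w => f.eval w) B, EquicontinuousIteratesAt f x := by
    intro x hx
    rcases x.cases with rfl | ⟨z, rfl⟩
    · exact equicontinuousIteratesAt_infty hf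
    · rw [toP1_injective.mem_set_image, orbitSet, Set.mem_ofPred_eq, not_forall] at hx
      obtain ⟨n, hn⟩ := hx
      refine .of_iterate n (equicontinuousIteratesAt_of_omits (b := b) hδ fun m w hw hmw => ?_)
      exact hdisk hn hw (hinv' m w (by rwa [hmw]))
  have hopen : IsRhoOpen (toP1 '' orbitSet (fun w => f.eval w) B)ᶜ := by
    intro x hx
    rcases x.cases with rfl | ⟨z, rfl⟩
    · refine ⟨1 / M, by positivity, ?_⟩
      rintro _ hy ⟨w, hw, rfl⟩
      have hwM : ‖w‖ ≤ M := by simpa using hBM (hw 0)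
      rw [chordal_infty_toP1] at hy
      exact hy.not_ge (one_div_le_one_div_of_le (lt_max_of_lt_right one_pos) (max_le hwM hM))
    · rw [Set.mem_compl_iff, toP1_injective.mem_set_image, orbitSet, Set.mem_ofPred_eq,
        not_forall] at hx
      obtain ⟨n, hn⟩ := hx
      obtain ⟨r, hr, hfr⟩ := Metric.continuous_iff.mp (f.continuous.iterate n) z δ hδ
      obtain ⟨ε, hε, hball⟩ := exists_chordal_ball_subset z hr
      refine ⟨ε, hε, ?_⟩
      rintro _ hy ⟨w, hw, rfl⟩
      obtain ⟨w', hw', hwr⟩ := hball _ hy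
      obtain rfl := toP1_injective hw'
      refine hdisk hn ?_ (hw n)
      rw [← dist_eq_norm] at hwr ⊢
      exact (hfr w hwr).le
  refine compl_eq_comm.mp (Set.Subset.antisymm ?_ ?_)
  · exact fun x hx => ⟨_, hx, hopen, hequi⟩
  · rintro _ ⟨U, hzU, -, hU⟩ ⟨z, hz, rfl⟩
    exact not_equicontinuousIteratesAt hE hlam hμ hM hBM hK hz (hU _ hzU)

end ProjectiveLine

/-- **Step 2 of the proof of Theorem 2.** If `f` and `g` are both expanding with constant
`λ > 1` on a non-empty bounded thick backward-invariant set `B`, `J(f)` is non-empty and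
`|f - g| ≤ μ` on `B` with `μ := min {|l|^{1/(l-1)} : 2 ≤ l ≤ d} · δ`, then `J(g)` is
non-empty and the dynamics of `f` and `g` on their Julia sets are conjugate. -/
theorem julia_conjugate_of_uniformly_close
    {p : ℕ} [Fact (Nat.Prime p)] {K : Type*} [NormedField K] [IsAlgClosed K]
    [CompleteSpace K] [IsUltrametricDist K] [Algebra ℚ_[p] K]
    (hext : ∀ q : ℚ_[p], ‖algebraMap ℚ_[p] K q‖ = ‖q‖)
    (d : ℕ) (hd : 2 ≤ d)
    (B : Set K) (hB : B.Nonempty)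
    (M : ℝ) (hM : 1 ≤ M) (hBM : B ⊆ Metric.closedBall 0 M)
    (δ : ℝ) (hδ : 0 < δ) (hδ1 : δ ≤ 1)
    (hthick : ∀ z ∈ B, Metric.closedBall z δ ⊆ B)
    (lam : ℝ) (hlam : 1 < lam)
    (f g : K[X]) (hdegf : f.natDegree = d) (hdegg : g.natDegree = d)
    (hexpf : ∀ z ∈ B, lam ≤ ‖(derivative f).eval z‖)
    (hexpg : ∀ z ∈ B, lam ≤ ‖(derivative g).eval z‖)
    (hinvf : (fun z => f.eval z) ⁻¹' B ⊆ B)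
    (hinvg : (fun z => g.eval z) ⁻¹' B ⊆ B)
    (hJ : (julia f).Nonempty)
    (hclose : ∀ z ∈ B, ‖f.eval z - g.eval z‖ ≤ muFactor p d * δ) :
    (julia g).Nonempty ∧ JuliaConjugate f g := by
  have hmu : 0 < muFactor p d * δ := mul_pos (muFactor_pos hd) hδ
  have hmuδ : muFactor p d * δ ≤ δ := mul_le_of_le_one_left hδ.le (muFactor_le_one hd)
  have hthick' : ∀ v ∈ B, ∀ u, ‖u - v‖ ≤ muFactor p d * δ → u ∈ B := fun v hv u hu =>
    hthick v hv (by rw [Metric.mem_closedBall, dist_eq_norm]; exact hu.trans hmuδ)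
  have hsmall : ∀ ε > 0, ∃ x : K, 0 < ‖x‖ ∧ ‖x‖ < ε := fun ε hε => by
    obtain ⟨q, hq0, hqε⟩ := NormedField.exists_norm_lt ℚ_[p] hε
    exact ⟨algebraMap ℚ_[p] K q, by rwa [hext], by rwa [hext]⟩
  have hexpands : ∀ q : K[X], q.natDegree = d → (∀ z ∈ B, lam ≤ ‖(derivative q).eval z‖) →
      ExpandsOn (fun w => q.eval w) B lam (muFactor p d * δ) := by
    intro q hdeg hexp v hv u hu
    have hdom : ConstTermDominates (taylor v q).divX (muFactor p d * δ) := by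
      refine constTermDominates_divX_taylor hext hdeg hδ fun w hw => norm_pos_iff.mp ?_
      exact (by linarith : 0 < lam).trans_le
        (hexp w (hthick v hv (by rwa [Metric.mem_closedBall, dist_eq_norm])))
    dsimp only
    rw [norm_eval_sub_eval_eq hdom hu]
    exact mul_le_mul_of_nonneg_right (hexp v hv) (norm_nonneg _)
  have hcovers : ∀ q : K[X], (∀ z ∈ B, lam ≤ ‖(derivative q).eval z‖) →
      CoversDisksOn (fun w => q.eval w) B (muFactor p d * δ) := fun q hexp v hv y hy =>
    exists_eval_eq_of_norm_sub_le hmu.le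
      (hy.trans (le_mul_of_one_le_left hmu.le (hlam.le.trans (hexp v hv))))
  have hEf := hexpands f hdegf hexpf
  have hEg := hexpands g hdegg hexpg
  have hJf := julia_eq_image_orbitSet (hdegf ▸ hd) hB hEf hlam hmu hM hBM hδ hthick hinvf hsmall
  have hJg := julia_eq_image_orbitSet (hdegg ▸ hd) hB hEg hlam hmu hM hBM hδ hthick hinvg hsmall
  obtain ⟨h, hh⟩ := exists_homeomorph_orbitSet hEf (hcovers f hexpf) f.continuous hEg
    (hcovers g hexpg) g.continuous hlam hmu hthick' hclose
  have hemb : Topology.IsEmbedding (toP1 : K → P1 K) := isOpenEmbedding_toP1.isEmbedding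
  rw [JuliaConjugate, hJf, hJg]
  refine ⟨?_, ((hemb.homeomorphImage _).symm.trans h).trans (hemb.homeomorphImage _), ?_⟩
  · rw [hJf] at hJ
    obtain ⟨_, z, hz, -⟩ := hJ
    exact ⟨_, _, (h ⟨z, hz⟩).2, rfl⟩
  · rintro _ ⟨z, hz, rfl⟩
    have htransfer : ∀ y (hy : y ∈ orbitSet (fun w => f.eval w) B),
        ((((hemb.homeomorphImage _).symm.trans h).trans (hemb.homeomorphImage _))
          ⟨toP1 y, y, hy, rfl⟩ : P1 K) = toP1 (h ⟨y, hy⟩ : K) := fun y hy =>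
      congrArg (fun x => toP1 (h x : K)) ((hemb.homeomorphImage _).symm_apply_apply ⟨y, hy⟩)
    exact ⟨⟨_, map_mem_orbitSet hz, rfl⟩, (htransfer _ (map_mem_orbitSet hz)).trans
      ((congrArg toP1 (hh ⟨z, hz⟩)).trans (congrArg (polyMap g) (htransfer z hz)).symm)⟩
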